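/- arXiv:1609.00309 — 2 statements merged into one kernel-verified Lean document; each statement's English description precedes it below -/
import Mathlib

section
/- For every even integer p > 2, the rational number N = ((p/2+1)(1 + ∑_{m=2}^{p/2} m!·C(p/2,m))) / ((p/2+1) + 2∑_{m=2}^{p/2} m!·C(p/2,m)) satisfies |N − (p+2)/4| < 1/2 and N ≠ (p+2)/4, so N is not an integer. -/
/-- The `m = 2` term bounds the sum of the falling factorials `m! * C(n, m)` from below. -/
theorem mul_sub_one_le_sum_factorial_mul_choose {n : ℕ} (hn : 2 ≤ n) :
    (n : ℚ) * (n - 1) ≤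
      ∑ m ∈ Finset.Icc 2 n, ((Nat.factorial m * Nat.choose n m : ℕ) : ℚ) := by
  have h := Finset.single_le_sum
    (f := fun m => ((Nat.factorial m * Nat.choose n m : ℕ) : ℚ)) (s := Finset.Icc 2 n)
    (fun m _ => Nat.cast_nonneg _) (Finset.mem_Icc.mpr ⟨le_rfl, hn⟩)
  refine le_trans (le_of_eq ?_) h
  push_cast [Nat.cast_choose_two]
  norm_num [Nat.factorial]
  ring

/-- If `A` is at least `n * (n - 1)`, the ratio `(n + 1) * (1 + A) / (n + 1 + 2 * A)` lies
strictly between `n / 2` and `(n + 1) / 2`. -/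
theorem ratio_mem_Ioo {n A : ℚ} (hn : 2 ≤ n) (hA : n * (n - 1) ≤ A) :
    (n + 1) * (1 + A) / (n + 1 + 2 * A) ∈ Set.Ioo (n / 2) ((n + 1) / 2) := by
  have hpos : 0 < n + 1 + 2 * A := by nlinarith
  constructor
  · rw [lt_div_iff₀ hpos]
    nlinarith
  · rw [div_lt_iff₀ hpos]
    nlinarith


/-- For every even integer `p > 2`, with `A = ∑_{m=2}^{p/2} m!·C(p/2,m)`, the
rational number `N = ((p/2+1)(1+A)) / ((p/2+1)+2A)` satisfies
`0 < |N − (p+2)/4| < 1/2`, and `N` is not an integer. -/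
theorem combinatorial_ratio_not_integer
    (p : ℕ) (hp : Even p) (hp2 : 2 < p) :
    0 < |(((p / 2 + 1 : ℕ) : ℚ)
            * (1 + (∑ m ∈ Finset.Icc 2 (p / 2),
                ((Nat.factorial m * Nat.choose (p / 2) m : ℕ) : ℚ))))
          / (((p / 2 + 1 : ℕ) : ℚ)
            + 2 * (∑ m ∈ Finset.Icc 2 (p / 2),
                ((Nat.factorial m * Nat.choose (p / 2) m : ℕ) : ℚ)))
          - ((p : ℚ) + 2) / 4| ∧
    |(((p / 2 + 1 : ℕ) : ℚ)
            * (1 + (∑ m ∈ Finset.Icc 2 (p / 2),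
                ((Nat.factorial m * Nat.choose (p / 2) m : ℕ) : ℚ))))
          / (((p / 2 + 1 : ℕ) : ℚ)
            + 2 * (∑ m ∈ Finset.Icc 2 (p / 2),
                ((Nat.factorial m * Nat.choose (p / 2) m : ℕ) : ℚ)))
          - ((p : ℚ) + 2) / 4| < 1 / 2 ∧
    ∀ z : ℤ,
      (((p / 2 + 1 : ℕ) : ℚ)
            * (1 + (∑ m ∈ Finset.Icc 2 (p / 2),
                ((Nat.factorial m * Nat.choose (p / 2) m : ℕ) : ℚ))))
          / (((p / 2 + 1 : ℕ) : ℚ)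
            + 2 * (∑ m ∈ Finset.Icc 2 (p / 2),
                ((Nat.factorial m * Nat.choose (p / 2) m : ℕ) : ℚ)))
        ≠ (z : ℚ) := by
  obtain ⟨n, rfl⟩ := hp.two_dvd
  have hn : 2 ≤ n := by omega
  rw [Nat.mul_div_cancel_left n two_pos]
  obtain ⟨hlo, hhi⟩ := ratio_mem_Ioo (by exact_mod_cast hn)
    (mul_sub_one_le_sum_factorial_mul_choose hn)
  rw [← Nat.cast_add_one] at hlo hhi
  generalize ((n + 1 : ℕ) : ℚ) * _ / _ = N at hlo hhi ⊢
  push_cast at hhi ⊢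
  refine ⟨abs_pos.mpr (by linarith), abs_lt.mpr ⟨by linarith, by linarith⟩, ?_⟩
  rintro z rfl
  have h₁ : (n : ℤ) < 2 * z := by
    have : (n : ℚ) < 2 * z := by linarith
    exact_mod_cast this
  have h₂ : 2 * z < (n : ℤ) + 1 := by
    have : 2 * (z : ℚ) < n + 1 := by linarith
    exact_mod_cast this
  omega
end

section
/- Let M_1 < ... < M_b be distinct square-free integers > 1 and ω_k = √M_k. Fix s > 1 and δ ∈ (0,1), and let N = |log δ|^s. There exist constants c′ > 0 and q > b² such that if n ∈ ℤ^b \ {0}, j ∈ ℤ^d, and n·ω ± √(j²+1) ≠ 0 for both signs, then |±n·ω + √(j²+1)| > c′ ‖n‖_1^{−q} for both signs. -/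
open Polynomial in
/-- The translates of an integer polynomial by `a` and `-a`, where `a ^ 2` is an integer, are
conjugate over `ℤ[X]`. -/
lemma exists_comp_X_add_C_eq_add_mul {a : ℝ} {z : ℤ} (ha : a ^ 2 = z) (p : ℤ[X]) :
    ∃ A B : ℤ[X],
      (p.map (Int.castRingHom ℝ)).comp (X + C a) =
        A.map (Int.castRingHom ℝ) + C a * B.map (Int.castRingHom ℝ) ∧
      (p.map (Int.castRingHom ℝ)).comp (X - C a) =
        A.map (Int.castRingHom ℝ) - C a * B.map (Int.castRingHom ℝ) := by
  have hC : (C a : ℝ[X]) ^ 2 = (C z : ℤ[X]).map (Int.castRingHom ℝ) := by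
    rw [← C_pow, ha]; simp
  induction p using Polynomial.induction_on with
  | C k => exact ⟨C k, 0, by simp, by simp⟩
  | add p q hp hq =>
    obtain ⟨A, B, h₁, h₂⟩ := hp
    obtain ⟨A', B', h₃, h₄⟩ := hq
    refine ⟨A + A', B + B', ?_, ?_⟩
    · simp only [Polynomial.map_add, add_comp, h₁, h₃]; ring
    · simp only [Polynomial.map_add, add_comp, h₂, h₄]; ring
  | monomial n k h =>
    obtain ⟨A, B, h₁, h₂⟩ := h
    refine ⟨A * X + C z * B, A + B * X, ?_, ?_⟩
    · rw [pow_succ, ← mul_assoc, Polynomial.map_mul, mul_comp, h₁]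
      simp only [Polynomial.map_add, Polynomial.map_mul, map_X, X_comp, ← hC]; ring
    · rw [pow_succ, ← mul_assoc, Polynomial.map_mul, mul_comp, h₂]
      simp only [Polynomial.map_add, Polynomial.map_mul, map_X, X_comp, ← hC]; ring

open Polynomial in
/-- A sum of square roots of integers is a root of a monic integer polynomial, all of whose roots
are real and bounded by the sum of the absolute values of the summands. -/
lemma exists_int_polynomial_of_sum_sqrt {ι : Type*} (s : Finset ι) (a : ι → ℝ)
    (ha : ∀ i, ∃ z : ℤ, a i ^ 2 = z) :
    ∃ (p : ℤ[X]) (S : Multiset ℝ), S.card = 2 ^ s.card ∧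
      p.map (Int.castRingHom ℝ) = (S.map fun t => X - C t).prod ∧
      (∀ t ∈ S, |t| ≤ ∑ i ∈ s, |a i|) ∧ ∑ i ∈ s, a i ∈ S := by
  classical
  induction s using Finset.induction_on with
  | empty => exact ⟨X, {0}, by simp, by simp, by simp, by simp⟩
  | insert i s hi ih =>
    obtain ⟨p, S, hcard, hp, hbd, hmem⟩ := ih
    obtain ⟨z, hz⟩ := ha i
    obtain ⟨A, B, h₁, h₂⟩ := exists_comp_X_add_C_eq_add_mul hz p
    have hC : (C (a i) : ℝ[X]) ^ 2 = (C z : ℤ[X]).map (Int.castRingHom ℝ) := by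
      rw [← C_pow, hz]; simp
    refine ⟨A ^ 2 - C z * B ^ 2, S.map (fun t => a i + t) + S.map (fun t => -a i + t),
      ?_, ?_, ?_, ?_⟩
    · rw [Multiset.card_add, Multiset.card_map, Multiset.card_map, hcard,
        Finset.card_insert_of_notMem hi]
      ring
    · have key : (A ^ 2 - C z * B ^ 2).map (Int.castRingHom ℝ) =
          (p.map (Int.castRingHom ℝ)).comp (X - C (a i)) *
            (p.map (Int.castRingHom ℝ)).comp (X + C (a i)) := by
        rw [h₁, h₂, Polynomial.map_sub, Polynomial.map_mul, ← hC]
        simp only [Polynomial.map_pow]; ring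
      rw [key, hp, Multiset.map_add, Multiset.prod_add, multiset_prod_comp, multiset_prod_comp]
      simp only [Multiset.map_map, Function.comp_def, sub_comp, X_comp, C_comp, C_add, C_neg]
      congr 3 <;> (funext t; ring)
    · intro t ht
      rw [Finset.sum_insert hi]
      rw [Multiset.mem_add, Multiset.mem_map, Multiset.mem_map] at ht
      rcases ht with ⟨u, hu, rfl⟩ | ⟨u, hu, rfl⟩
      · exact (abs_add_le _ _).trans (add_le_add le_rfl (hbd u hu))
      · refine (abs_add_le _ _).trans (add_le_add ?_ (hbd u hu))
        rw [abs_neg]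
    · rw [Finset.sum_insert hi]
      exact Multiset.mem_add.2 (Or.inl (Multiset.mem_map.2 ⟨_, hmem, rfl⟩))

open Polynomial in
/-- If an integer polynomial is monic with real roots, then the product of its nonzero roots has
absolute value at least one. -/
lemma one_le_abs_prod_filter_ne_zero {p : ℤ[X]} {S : Multiset ℝ}
    (hp : p.map (Int.castRingHom ℝ) = (S.map fun t => X - C t).prod) :
    1 ≤ ((S.filter (· ≠ 0)).map fun t => |t|).prod := by
  classical
  set T := S.filter (· ≠ 0) with hT
  set r := (S.filter fun t => ¬ t ≠ 0).card
  have hsplit : p.map (Int.castRingHom ℝ) = (T.map fun t => X - C t).prod * X ^ r := by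
    rw [hp, ← Multiset.filter_add_not (· ≠ 0) S, Multiset.map_add, Multiset.prod_add]
    congr 1
    rw [← Multiset.prod_replicate, ← Multiset.map_const']
    · refine congrArg _ (Multiset.map_congr rfl fun t ht => ?_)
      simp [not_not.1 (Multiset.mem_filter.1 ht).2]
  have hcoeff : ((p.coeff r : ℤ) : ℝ) = (T.map fun t => -t).prod := by
    have h := congrArg (fun f : ℝ[X] => f.coeff r) hsplit
    simp only [coeff_map, eq_intCast] at h
    have h' := coeff_mul_X_pow (T.map fun t : ℝ => X - C t).prod r 0
    rw [zero_add] at h'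
    rw [h, h', coeff_zero_eq_eval_zero, eval_multiset_prod, Multiset.map_map]
    simp
  have habs : |((p.coeff r : ℤ) : ℝ)| = (T.map fun t => |t|).prod := by
    have h := map_multiset_prod (absHom : ℝ →*₀ ℝ) (T.map fun t => -t)
    rw [Multiset.map_map] at h
    simpa [absHom, hcoeff] using h
  have hne : p.coeff r ≠ 0 := by
    intro h0
    rw [h0, Int.cast_zero, abs_zero, eq_comm, Multiset.prod_eq_zero_iff, Multiset.mem_map] at habs
    obtain ⟨t, ht, ht0⟩ := habs
    exact (Multiset.mem_filter.1 ht).2 (abs_eq_zero.1 ht0)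
  rw [← habs]
  exact_mod_cast Int.one_le_abs hne

/-- Liouville's inequality for sums of square roots of integers. -/
lemma one_le_abs_sum_mul_pow {ι : Type*} (s : Finset ι) (a : ι → ℝ)
    (ha : ∀ i, ∃ z : ℤ, a i ^ 2 = z) {B : ℝ} (hB : 1 ≤ B) (hle : ∑ i ∈ s, |a i| ≤ B)
    (hne : ∑ i ∈ s, a i ≠ 0) :
    1 ≤ |∑ i ∈ s, a i| * B ^ 2 ^ s.card := by
  classical
  obtain ⟨p, S, hcard, hp, hbd, hmem⟩ := exists_int_polynomial_of_sum_sqrt s a ha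
  obtain ⟨T, hT⟩ := Multiset.exists_cons_of_mem
    (Multiset.mem_filter.2 ⟨hmem, hne⟩ : ∑ i ∈ s, a i ∈ S.filter (· ≠ 0))
  have h := one_le_abs_prod_filter_ne_zero hp
  rw [hT, Multiset.map_cons, Multiset.prod_cons] at h
  refine h.trans (mul_le_mul_of_nonneg_left ?_ (abs_nonneg _))
  have hTS : T ≤ S := (Multiset.le_cons_self T _).trans (hT ▸ Multiset.filter_le _ S)
  calc (T.map fun t => |t|).prod ≤ (T.map fun _ => B).prod :=
        Multiset.prod_map_le_prod_map₀ _ _ (fun t _ => abs_nonneg t)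
          fun t ht => (hbd t (Multiset.mem_of_le hTS ht)).trans hle
    _ = B ^ T.card := by simp
    _ ≤ B ^ 2 ^ s.card := pow_le_pow_right₀ hB (hcard ▸ Multiset.card_le_card hTS)

/-- Lower bound for a nonzero `n·ω + y`, where `ω k = √(M k)` and `y ^ 2` is an integer. -/
lemma lt_abs_sum_mul_sqrt_add {b : ℕ} (M : Fin b → ℕ) {n : Fin b → ℤ} (hn : n ≠ 0)
    {y q : ℝ} (hy : ∃ z : ℤ, y ^ 2 = z) (hq : (2 : ℝ) ^ (b + 1) ≤ q)
    (hne : (∑ k, (n k : ℝ) * √(M k)) + y ≠ 0) :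
    ((3 * (1 + ∑ k, √(M k))) ^ 2 ^ (b + 1))⁻¹ / 2 * (∑ k, |(n k : ℝ)|) ^ (-q) <
      |(∑ k, (n k : ℝ) * √(M k)) + y| := by
  set W : ℝ := 1 + ∑ k, √(M k)
  set L : ℝ := ∑ k, |(n k : ℝ)|
  set D : ℕ := 2 ^ (b + 1) with hD
  set x : ℝ := (∑ k, (n k : ℝ) * √(M k)) + y
  have hW : 1 ≤ W := le_add_of_nonneg_right (Finset.sum_nonneg fun k _ => Real.sqrt_nonneg _)
  have hL : 1 ≤ L := by
    obtain ⟨k, hk⟩ := Function.ne_iff.1 hn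
    calc (1 : ℝ) ≤ |(n k : ℝ)| := by exact_mod_cast Int.one_le_abs hk
      _ ≤ L := Finset.single_le_sum (f := fun k => |(n k : ℝ)|) (fun i _ => abs_nonneg _)
        (Finset.mem_univ k)
  have hsum : ∑ k, |(n k : ℝ) * √(M k)| ≤ L * W := by
    rw [Finset.sum_mul]
    refine Finset.sum_le_sum fun k _ => ?_
    rw [abs_mul, abs_of_nonneg (Real.sqrt_nonneg _)]
    refine mul_le_mul_of_nonneg_left ?_ (abs_nonneg _)
    have := Finset.single_le_sum (f := fun k => √(M k : ℝ)) (fun i _ => Real.sqrt_nonneg _)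
      (Finset.mem_univ k)
    exact this.trans (le_add_of_nonneg_left zero_le_one)
  have hLW : 1 ≤ L * W := one_le_mul_of_one_le_of_one_le hL hW
  have hWD : 1 ≤ (3 * W) ^ D := one_le_pow₀ (by linarith)
  have hLD : 1 ≤ L ^ D := one_le_pow₀ hL
  have hrpow : L ^ (-q) ≤ (L ^ D)⁻¹ := by
    rw [← Real.rpow_natCast, ← Real.rpow_neg (by linarith)]
    refine Real.rpow_le_rpow_of_exponent_le hL (neg_le_neg ?_)
    rw [hD]; push_cast; exact hq
  have hbound : ((3 * W) ^ D)⁻¹ / 2 * L ^ (-q) ≤ ((3 * W * L) ^ D)⁻¹ / 2 := by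
    calc _ ≤ ((3 * W) ^ D)⁻¹ / 2 * (L ^ D)⁻¹ :=
          mul_le_mul_of_nonneg_left hrpow (by positivity)
      _ = _ := by rw [mul_pow (3 * W), mul_inv]; ring
  refine hbound.trans_lt ?_
  have hpos : 1 ≤ (3 * W * L) ^ D := one_le_pow₀ (by nlinarith)
  have hinv : ((3 * W * L) ^ D)⁻¹ / 2 < ((3 * W * L) ^ D)⁻¹ := half_lt_self (by positivity)
  refine hinv.trans_le ?_
  rcases le_or_gt 1 |x| with hx | hx
  · exact (inv_le_one_of_one_le₀ hpos).trans hx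
  · have hyle : |y| ≤ 1 + L * W := by
      have h1 : y = x - ∑ k, (n k : ℝ) * √(M k) := by simp [x]
      have h2 := abs_sub x (∑ k, (n k : ℝ) * √(M k))
      have h3 := Finset.abs_sum_le_sum_abs (fun k => (n k : ℝ) * √(M k)) Finset.univ
      rw [← h1] at h2
      linarith
    have hx' : ∑ i, (Fin.cons y fun k => (n k : ℝ) * √(M k) : Fin (b + 1) → ℝ) i = x := by
      rw [Fin.sum_univ_succ]; simp [x, add_comm]
    have key := one_le_abs_sum_mul_pow Finset.univ
      (Fin.cons y fun k => (n k : ℝ) * √(M k) : Fin (b + 1) → ℝ) (B := 3 * W * L) ?_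
      (by nlinarith) ?_ (hx' ▸ hne)
    · rw [hx', Finset.card_univ, Fintype.card_fin] at key
      exact (inv_le_iff_one_le_mul₀ (by positivity)).2 key
    · refine Fin.cases hy fun k => ⟨n k ^ 2 * M k, ?_⟩
      simp [mul_pow]
    · rw [Fin.sum_univ_succ]
      simp only [Fin.cons_zero, Fin.cons_succ]
      linarith


/-- Diophantine lower bound: with `ω k = √(M k)`, `M 1 < ... < M b` distinct
square-free integers `> 1`, there are `c' > 0` and `q > b²` such that for every
nonzero `n ∈ ℤ^b` and every `j ∈ ℤ^d`, if `n·ω ± √(j²+1) ≠ 0` for both signs,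
then `|n·ω ± √(j²+1)| > c' ‖n‖₁^(−q)` for both signs. -/
theorem small_divisor_lower_bound
    (b d : ℕ) (M : Fin b → ℕ)
    (hsf : ∀ k, Squarefree (M k))
    (hgt : ∀ k, 1 < M k)
    (hmono : StrictMono M)
    (s δ : ℝ) (hs : 1 < s) (hδ : 0 < δ ∧ δ < 1) :
    ∃ c' > (0 : ℝ), ∃ q : ℝ, (b : ℝ) ^ 2 < q ∧
      ∀ n : Fin b → ℤ, n ≠ 0 → ∀ j : Fin d → ℤ,
        ((∑ k, (n k : ℝ) * Real.sqrt (M k)) + Real.sqrt ((∑ i, (j i : ℝ) ^ 2) + 1) ≠ 0 ∧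
         (∑ k, (n k : ℝ) * Real.sqrt (M k)) - Real.sqrt ((∑ i, (j i : ℝ) ^ 2) + 1) ≠ 0) →
        (|(∑ k, (n k : ℝ) * Real.sqrt (M k)) + Real.sqrt ((∑ i, (j i : ℝ) ^ 2) + 1)|
            > c' * (∑ k, |(n k : ℝ)|) ^ (-q) ∧
         |(∑ k, (n k : ℝ) * Real.sqrt (M k)) - Real.sqrt ((∑ i, (j i : ℝ) ^ 2) + 1)|
            > c' * (∑ k, |(n k : ℝ)|) ^ (-q)) := by
  have hq : (2 : ℝ) ^ (b + 1) ≤ 2 ^ (b + 1) + (b : ℝ) ^ 2 := le_add_of_nonneg_right (by positivity)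
  refine ⟨((3 * (1 + ∑ k, √(M k))) ^ 2 ^ (b + 1))⁻¹ / 2, ?_, 2 ^ (b + 1) + (b : ℝ) ^ 2,
    lt_add_of_pos_left _ (by positivity), ?_⟩
  · have : 0 ≤ ∑ k, √(M k : ℝ) := Finset.sum_nonneg fun k _ => Real.sqrt_nonneg _
    positivity
  · rintro n hn j ⟨hadd, hsub⟩
    have hsq : √((∑ i, (j i : ℝ) ^ 2) + 1) ^ 2 = ((∑ i, j i ^ 2 + 1 : ℤ) : ℝ) := by
      rw [Real.sq_sqrt (by positivity)]; push_cast; rfl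
    refine ⟨lt_abs_sum_mul_sqrt_add M hn ⟨_, hsq⟩ hq hadd, ?_⟩
    rw [sub_eq_add_neg] at hsub ⊢
    exact lt_abs_sum_mul_sqrt_add M hn ⟨_, (neg_sq _).trans hsq⟩ hq hsub
end
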